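/- Moment expansion of the Fourier transform: let f : ℝ → ℝ be integrable and compactly supported. Then for every u ∈ ℝ, the series Σ_{p=0}^{∞} ((−2πi u)^p / p!) m_p(f) converges (as a sum in ℂ) to 𝓕(f)(u); that is, the Fourier transform of f is given by the everywhere-convergent power series whose coefficients are, up to the factor (−2πi)^p/p!, the geometric moments of f. -/

import Mathlib

open MeasureTheory

/-- The Fourier transform `𝓕(f)(u) = ∫ f(x) e^{-2πixu} dx` of a function on `ℝ`. -/
noncomputable def ft (f : ℝ → ℝ) (u : ℝ) : ℂ :=
  ∫ x : ℝ, Complex.exp (-(2 * Real.pi * Complex.I) * (x : ℂ) * (u : ℂ)) * (f x : ℂ)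

/-- The geometric moment `m_p(f) = ∫ x^p f(x) dx`. -/
noncomputable def gm (p : ℕ) (f : ℝ → ℝ) : ℝ :=
  ∫ x, x ^ p * f x

/-- Moment expansion of the Fourier transform: for an integrable compactly supported `f`,
the series `∑_p ((-2πiu)^p / p!) m_p(f)` converges to `𝓕(f)(u)` for every `u`. -/
theorem ft_moment_expansion (f : ℝ → ℝ) (hf : Integrable f volume)
    (hfc : HasCompactSupport f) (u : ℝ) :
    HasSum (fun p : ℕ =>
      ((-(2 * Real.pi * Complex.I) * (u : ℂ)) ^ p / (p.factorial : ℂ)) * (gm p f : ℂ))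
      (ft f u) := by
  obtain ⟨R, hR⟩ := hfc.isCompact.isBounded.exists_norm_le
  set c : ℂ := -(2 * Real.pi * Complex.I) * (u : ℂ) with hc
  have hexp : ∀ z : ℂ, HasSum (fun p : ℕ => z ^ p / (p.factorial : ℂ)) (Complex.exp z) := by
    intro z
    rw [Complex.exp_eq_exp_ℂ]
    exact NormedSpace.expSeries_div_hasSum_exp z
  have hsum : Summable fun p : ℕ => (‖c‖ * R) ^ p / (p.factorial : ℝ) :=
    Real.summable_pow_div_factorial _
  have hterm : ∀ p : ℕ, c ^ p / (p.factorial : ℂ) * (gm p f : ℂ) =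
      ∫ x : ℝ, (c * (x : ℂ)) ^ p / (p.factorial : ℂ) * (f x : ℂ) := by
    intro p
    rw [gm, ← integral_complex_ofReal, ← integral_const_mul]
    congr 1
    ext x
    push_cast
    ring
  simp_rw [hterm, ft]
  refine hasSum_integral_of_dominated_convergence
    (fun p x => (‖c‖ * R) ^ p / (p.factorial : ℝ) * ‖f x‖) ?_ ?_ ?_ ?_ ?_
  · intro p
    exact (by fun_prop : Continuous fun x : ℝ =>
      (c * (x : ℂ)) ^ p / (p.factorial : ℂ)).aestronglyMeasurable.mul
        hf.ofReal.aestronglyMeasurable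
  · refine fun p => .of_forall fun x => ?_
    by_cases hx : f x = 0
    · simp [hx]
    · have hxR : ‖x‖ ≤ R := hR x (subset_tsupport f hx)
      rw [norm_mul, norm_div, norm_pow, norm_mul, Complex.norm_natCast, Complex.norm_real,
        Complex.norm_real]
      gcongr
  · exact .of_forall fun x => hsum.mul_right _
  · simp_rw [tsum_mul_right]
    exact hf.norm.const_mul _
  · refine .of_forall fun x => ?_
    have hphase : -(2 * Real.pi * Complex.I) * (x : ℂ) * (u : ℂ) = c * x := by
      rw [hc]
      ring
    rw [hphase]
    exact (hexp (c * x)).mul_right (f x : ℂ)
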